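/- Let G be a vertex-weighted graph with positive weights, let v be a vertex of G, and let G' be obtained from G by the extended weighted struction at v. Then α_w(G) ≥ α_w(G') + w(v), i.e., for every independent set I' of G' there exists an independent set I of G whose weight in G equals the weight of I' in G' plus w(v). -/

import Mathlib

/-!
Extended weighted struction: applied at an arbitrary vertex `v`.  It removes
`v` together with its whole neighborhood `N(v)`, and adds, for every
independent set `c` of `G[N(v)]` with `w(c) > w(v)`, a new vertex `v_c` of
weight `w(c) - w(v)`; `v_c` is adjacent to every remaining vertex adjacent
in `G` to some vertex of `c`, and the new vertices form a clique.
-/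

open scoped Classical

variable {V : Type*}

/-- `I` is an independent set of `G`. -/
def IsIndep (G : SimpleGraph V) (I : Finset V) : Prop :=
  ∀ x ∈ I, ∀ y ∈ I, ¬ G.Adj x y

/-- The weighted independence number of `G` with weights `w`: the supremum
(for a finite graph, the maximum) of the weights of independent sets. -/
noncomputable def alphaW (G : SimpleGraph V) (w : V → ℝ) : ℝ :=
  sSup {r : ℝ | ∃ I : Finset V, IsIndep G I ∧ r = ∑ x ∈ I, w x}

/-- Old vertices of the extended struction at `v`: the vertices outside the
closed neighborhood `N[v]`. -/
abbrev ExtOld (G : SimpleGraph V) (v : V) : Type _ :=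
  {u : V // u ≠ v ∧ ¬ G.Adj v u}

/-- New vertices of the extended struction at `v`: the independent sets `c`
of the induced subgraph `G[N(v)]` with `w(c) > w(v)`. -/
abbrev ExtNew (G : SimpleGraph V) (w : V → ℝ) (v : V) : Type _ :=
  {c : Finset V // (∀ x ∈ c, G.Adj v x) ∧ IsIndep G c ∧ w v < ∑ x ∈ c, w x}

/-- Adjacency for the extended weighted struction at `v`:
old vertices keep the edges of `G`; a new vertex `v_c` is adjacent to every
old vertex adjacent in `G` to at least one vertex of `c`; the new vertices
form a clique. -/
def extRel (G : SimpleGraph V) (w : V → ℝ) (v : V) :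
    ExtOld G v ⊕ ExtNew G w v → ExtOld G v ⊕ ExtNew G w v → Prop
  | Sum.inl u, Sum.inl u' => G.Adj u.val u'.val
  | Sum.inl u, Sum.inr c => ∃ x ∈ c.val, G.Adj u.val x
  | Sum.inr c, Sum.inl u => ∃ x ∈ c.val, G.Adj u.val x
  | Sum.inr _, Sum.inr _ => True

/-- The graph obtained from `G` by the extended weighted struction at `v`. -/
def extStruction (G : SimpleGraph V) (w : V → ℝ) (v : V) :
    SimpleGraph (ExtOld G v ⊕ ExtNew G w v) :=
  SimpleGraph.fromRel (extRel G w v)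

/-- Weights after the extended struction: old vertices keep their weight and
each new vertex `v_c` has weight `w(c) - w(v)`. -/
noncomputable def extWeight (G : SimpleGraph V) (w : V → ℝ) (v : V) :
    ExtOld G v ⊕ ExtNew G w v → ℝ
  | Sum.inl u => w u.val
  | Sum.inr c => (∑ x ∈ c.val, w x) - w v

/-- The old vertices of a set `I'` of struction vertices, seen back in `V`. -/
noncomputable def extOldBack (G : SimpleGraph V) (w : V → ℝ) (v : V) [Fintype V]
    (I' : Finset (ExtOld G v ⊕ ExtNew G w v)) : Finset V :=
  Finset.univ.filter fun y =>
    ∃ h : y ≠ v ∧ ¬ G.Adj v y, Sum.inl (⟨y, h⟩ : ExtOld G v) ∈ I'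

theorem exists_isIndep_sum_eq_add (G : SimpleGraph V) (w : V → ℝ) (v : V)
    (I' : Finset (ExtOld G v ⊕ ExtNew G w v)) (hI' : IsIndep (extStruction G w v) I') :
    ∃ I : Finset V, IsIndep G I ∧
      ∑ x ∈ I, w x = (∑ a ∈ I', extWeight G w v a) + w v := by
  have hold : ∀ a ∈ I'.toLeft, ∀ b ∈ I'.toLeft, ¬ G.Adj a.val b.val := by
    intro a ha b hb hab
    refine hI' _ (Finset.mem_toLeft.1 ha) _ (Finset.mem_toLeft.1 hb) ?_
    exact ⟨fun h => hab.ne (congrArg Subtype.val (Sum.inl_injective h)), Or.inl hab⟩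
  have hnew : ∀ c ∈ I'.toRight, ∀ d ∈ I'.toRight, c = d := by
    intro c hc d hd
    by_contra hcd
    refine hI' _ (Finset.mem_toRight.1 hc) _ (Finset.mem_toRight.1 hd) ?_
    exact ⟨fun h => hcd (Sum.inr_injective h), Or.inl trivial⟩
  have hmix : ∀ a ∈ I'.toLeft, ∀ c ∈ I'.toRight, ∀ x ∈ c.val, ¬ G.Adj a.val x := by
    intro a ha c hc x hx hax
    refine hI' _ (Finset.mem_toLeft.1 ha) _ (Finset.mem_toRight.1 hc) ?_
    exact ⟨Sum.inl_ne_inr, Or.inl ⟨x, hx, hax⟩⟩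
  set O : Finset V := I'.toLeft.map (Function.Embedding.subtype _) with hO
  have hmem : ∀ x ∈ O, ∃ a ∈ I'.toLeft, a.val = x := by
    intro x hx
    simpa only [hO, Finset.mem_map, Function.Embedding.subtype_apply] using hx
  have hsum : ∑ x ∈ O, w x = ∑ a ∈ I'.toLeft, extWeight G w v (Sum.inl a) := by
    simp only [hO, Finset.sum_map]
    rfl
  rw [Finset.sum_sum_eq_sum_toLeft_add_sum_toRight, ← hsum]
  rcases I'.toRight.eq_empty_or_nonempty with hR | ⟨c, hc⟩
  · refine ⟨insert v O, ?_, ?_⟩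
    · intro x hx y hy hxy
      rcases Finset.mem_insert.1 hx with rfl | hx <;> rcases Finset.mem_insert.1 hy with rfl | hy
      · exact hxy.ne rfl
      · obtain ⟨b, hb, rfl⟩ := hmem y hy
        exact b.2.2 hxy
      · obtain ⟨a, ha, rfl⟩ := hmem x hx
        exact a.2.2 hxy.symm
      · obtain ⟨a, ha, rfl⟩ := hmem x hx
        obtain ⟨b, hb, rfl⟩ := hmem y hy
        exact hold a ha b hb hxy
    · have hv : v ∉ O := fun h => by
        obtain ⟨a, -, ha⟩ := hmem v h
        exact a.2.1 ha
      rw [Finset.sum_insert hv, hR, Finset.sum_empty]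
      ring
  · have hR : I'.toRight = {c} :=
      Finset.eq_singleton_iff_unique_mem.2 ⟨hc, fun d hd => hnew d hd c hc⟩
    refine ⟨O ∪ c.val, ?_, ?_⟩
    · intro x hx y hy hxy
      rcases Finset.mem_union.1 hx with hx | hx <;> rcases Finset.mem_union.1 hy with hy | hy
      · obtain ⟨a, ha, rfl⟩ := hmem x hx
        obtain ⟨b, hb, rfl⟩ := hmem y hy
        exact hold a ha b hb hxy
      · obtain ⟨a, ha, rfl⟩ := hmem x hx
        exact hmix a ha c hc y hy hxy
      · obtain ⟨b, hb, rfl⟩ := hmem y hy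
        exact hmix b hb c hc x hx hxy.symm
      · exact c.2.2.1 x hx y hy hxy
    · have hd : Disjoint O c.val := Finset.disjoint_left.2 fun x hx hxc => by
        obtain ⟨a, -, rfl⟩ := hmem x hx
        exact a.2.2 (c.2.1 _ hxc)
      rw [Finset.sum_union hd, hR, Finset.sum_singleton]
      simp only [extWeight]
      ring

theorem sum_le_alphaW [Finite V] (G : SimpleGraph V) (w : V → ℝ) {I : Finset V}
    (hI : IsIndep G I) : ∑ x ∈ I, w x ≤ alphaW G w := by
  refine le_csSup (Set.Finite.bddAbove ?_) ⟨I, hI, rfl⟩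
  refine (Set.finite_range fun J : Finset V => ∑ x ∈ J, w x).subset ?_
  rintro r ⟨J, -, rfl⟩
  exact ⟨J, rfl⟩

/-- `α_w(G) ≥ α_w(G') + w(v)` for the extended weighted
struction: for every independent set `I'` of `G'` there is an independent
set `I` of `G` whose weight in `G` equals the weight of `I'` in `G'` plus
`w v`; consequently the weighted independence numbers satisfy the
corresponding inequality. -/
theorem extended_struction_lower_bound [Fintype V]
    (G : SimpleGraph V) (w : V → ℝ) (hw : ∀ u, 0 < w u) (v : V) :
    (∀ I' : Finset (ExtOld G v ⊕ ExtNew G w v), IsIndep (extStruction G w v) I' →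
        ∃ I : Finset V, IsIndep G I ∧
          ∑ x ∈ I, w x = (∑ a ∈ I', extWeight G w v a) + w v) ∧
      alphaW (extStruction G w v) (extWeight G w v) + w v ≤ alphaW G w := by
  refine ⟨fun I' hI' => exists_isIndep_sum_eq_add G w v I' hI', ?_⟩
  rw [← le_sub_iff_add_le]
  refine csSup_le ⟨0, ∅, by simp [IsIndep], by simp⟩ ?_
  rintro r ⟨I', hI', rfl⟩
  obtain ⟨I, hI, hsum⟩ := exists_isIndep_sum_eq_add G w v I' hI'
  rw [le_sub_iff_add_le, ← hsum]
  exact sum_le_alphaW G w hI
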